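/- arXiv:math/0703693 — 3 statements merged into one kernel-verified Lean document; each statement's English description precedes it below -/
import Mathlib

section
/- For integers n ≥ 2 and k ≥ 1, let B_k(n) = ∫₀¹ (k+t)^{n−3/2} (t−1/2) dt and D_k(n) = Σ_{l=k+1}^∞ l^{−n−1/2}. Then lim_{n→∞} (n − 3/2) Σ_{k=n}^∞ B_k(n) D_k(n) = ∫₀¹ φ(α) dα, where φ(α) = (α e^α − 2 e^α + α + 2)/(2α² (e^α − 1)). -/
open Filter Real Topology

theorem aux_sum (c : ℝ) (hc : 0 < c) :
    (∀ l : ℕ, 0 ≤ 1 / (1 + c * ((l : ℝ) + 1)) ^ 2) ∧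
    ∀ N : ℕ, ∑ l ∈ Finset.range N, 1 / (1 + c * ((l : ℝ) + 1)) ^ 2 ≤ 1 / c := by
  refine ⟨fun l => by positivity, fun N => ?_⟩
  have h : ∑ l ∈ Finset.range N, 1 / (1 + c * ((l : ℝ) + 1)) ^ 2
      ≤ 1 / c * (1 - 1 / (1 + c * N)) := by
    induction N with
    | zero => simp
    | succ N ih =>
      rw [Finset.sum_range_succ]
      have h1 : 1 / (1 + c * ((N : ℝ) + 1)) ^ 2 ≤
          1 / c * (1 / (1 + c * N) - 1 / (1 + c * (N + 1))) := by
        have : 1 / c * (1 / (1 + c * N) - 1 / (1 + c * (N + 1)))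
          = 1 / ((1 + c * N) * (1 + c * (N + 1))) := by
          have : 0 < 1 + c * N := by positivity
          have : 0 < 1 + c * ((N : ℝ) + 1) := by positivity
          field_simp
          ring
        rw [this]
        apply one_div_le_one_div_of_le (by positivity)
        rw [sq]
        gcongr
        linarith
      push_cast
      calc _ ≤ _ := add_le_add ih h1
        _ = _ := by ring
  refine h.trans ?_
  have : 0 ≤ 1 / (1 + c * (N : ℝ)) := by positivity
  have hc' : 0 ≤ 1 / c := by positivity
  nlinarith

theorem aux_summable (c : ℝ) (hc : 0 < c) :
    Summable (fun l : ℕ => 1 / (1 + c * ((l : ℝ) + 1)) ^ 2) :=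
  summable_of_sum_range_le (aux_sum c hc).1 (aux_sum c hc).2

theorem aux_tsum (c : ℝ) (hc : 0 < c) :
    ∑' l : ℕ, 1 / (1 + c * ((l : ℝ) + 1)) ^ 2 ≤ 1 / c :=
  Real.tsum_le_of_sum_range_le (aux_sum c hc).1 (aux_sum c hc).2

theorem aux_term (n k : ℕ) (hn : 2 ≤ n) (hk : 1 ≤ k) (l : ℕ) :
    (1 + ((l : ℝ) + 1) / k) ^ (-(n : ℝ) - 1 / 2) ≤
      1 / (1 + ((n : ℝ) / (2 * k)) * ((l : ℝ) + 1)) ^ 2 := by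
  have hk' : (0 : ℝ) < k := by exact_mod_cast hk
  have hn' : (2 : ℝ) ≤ n := by exact_mod_cast hn
  have hs : 0 ≤ ((l : ℝ) + 1) / k := by positivity
  have h1 := one_add_mul_self_le_rpow_one_add (s := ((l : ℝ) + 1) / k) (by linarith)
    (p := (n : ℝ) / 2) (by linarith)
  have h2 : (1 + ((l : ℝ) + 1) / k) ^ (-(n : ℝ) - 1 / 2) ≤
      (1 + ((l : ℝ) + 1) / k) ^ (-(n : ℝ)) :=
    rpow_le_rpow_of_exponent_le (by linarith) (by linarith)
  refine h2.trans ?_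
  rw [rpow_neg (by positivity), ← one_div]
  apply one_div_le_one_div_of_le (by positivity)
  have h3 : (1 + ((l : ℝ) + 1) / k) ^ (n : ℝ) = ((1 + ((l : ℝ) + 1) / k) ^ ((n : ℝ) / 2)) ^ 2 := by
    rw [← rpow_natCast, ← rpow_mul (by positivity)]
    congr 1
    push_cast
    ring
  rw [h3]
  apply pow_le_pow_left₀ (by positivity)
  calc _ = _ := by ring
    _ ≤ _ := h1

theorem aux_d_bound (n k : ℕ) (hn : 2 ≤ n) (hk : 1 ≤ k) :
    |∑' l : ℕ, (1 + ((l : ℝ) + 1) / k) ^ (-(n : ℝ) - 1 / 2)| ≤ 2 * k / n := by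
  have hk' : (0 : ℝ) < k := by exact_mod_cast hk
  have hn' : (2 : ℝ) ≤ n := by exact_mod_cast hn
  have hc : (0 : ℝ) < (n : ℝ) / (2 * k) := by positivity
  have hnn : ∀ l : ℕ, 0 ≤ (1 + ((l : ℝ) + 1) / k) ^ (-(n : ℝ) - 1 / 2) := fun l => by positivity
  rw [abs_of_nonneg (tsum_nonneg hnn)]
  have hsm := Summable.of_nonneg_of_le hnn (aux_term n k hn hk) (aux_summable _ hc)
  refine (hsm.tsum_le_tsum (aux_term n k hn hk) (aux_summable _ hc)).trans ?_
  refine (aux_tsum _ hc).trans (le_of_eq ?_)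
  field_simp

theorem aux_le_exp (n k : ℕ) (hn : 2 ≤ n) (hk : 1 ≤ k) (t : ℝ) (ht0 : 0 ≤ t) (ht1 : t ≤ 1) :
    (1 + t / k) ^ ((n : ℝ) - 3 / 2) ≤ exp ((n : ℝ) / k) := by
  have hk' : (0 : ℝ) < k := by exact_mod_cast hk
  have hn' : (2 : ℝ) ≤ n := by exact_mod_cast hn
  have h1 : 1 + t / k ≤ exp (t / k) := by linarith [Real.add_one_le_exp (t / k)]
  have h2 := rpow_le_rpow (by positivity) h1 (show (0 : ℝ) ≤ (n : ℝ) - 3 / 2 by linarith)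
  refine h2.trans ?_
  rw [← Real.exp_mul]
  apply Real.exp_le_exp.mpr
  rw [div_mul_eq_mul_div]
  gcongr
  nlinarith

theorem aux_int_half : ∫ t in (0:ℝ)..1, (t - 1 / 2) = 0 := by
  rw [intervalIntegral.integral_sub (by simp) (by simp)]
  simp

theorem aux_cont (n k : ℕ) (hk : 1 ≤ k) :
    ContinuousOn (fun t : ℝ => (1 + t / k) ^ ((n : ℝ) - 3 / 2) * (t - 1 / 2)) (Set.Icc 0 1) := by
  have hk' : (0 : ℝ) < k := by exact_mod_cast hk
  refine ContinuousOn.mul (ContinuousOn.rpow_const (by fun_prop) ?_) (by fun_prop)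
  intro t ht
  left
  have : 0 ≤ t / k := div_nonneg ht.1 hk'.le
  positivity

theorem aux_b_bound (n k : ℕ) (hn : 2 ≤ n) (hk : n ≤ k) :
    |∫ t in (0:ℝ)..1, (1 + t / k) ^ ((n : ℝ) - 3 / 2) * (t - 1 / 2)| ≤ 3 * n / k := by
  have hk1 : 1 ≤ k := by omega
  have hk' : (0 : ℝ) < k := by exact_mod_cast hk1
  have hn' : (2 : ℝ) ≤ n := by exact_mod_cast hn
  have e : ∫ t in (0:ℝ)..1, (1 + t / k) ^ ((n : ℝ) - 3 / 2) * (t - 1 / 2) =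
      ∫ t in (0:ℝ)..1, ((1 + t / k) ^ ((n : ℝ) - 3 / 2) - 1) * (t - 1 / 2) := by
    have : ∀ t : ℝ, ((1 + t / k) ^ ((n : ℝ) - 3 / 2) - 1) * (t - 1 / 2) =
      (1 + t / k) ^ ((n : ℝ) - 3 / 2) * (t - 1 / 2) - (t - 1 / 2) := fun t => by ring
    simp_rw [this]
    rw [intervalIntegral.integral_sub _ (by apply Continuous.intervalIntegrable; fun_prop), aux_int_half, sub_zero]
    apply ContinuousOn.intervalIntegrable
    rw [Set.uIcc_of_le zero_le_one]
    exact aux_cont n k hk1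
  rw [e]
  have := intervalIntegral.norm_integral_le_of_norm_le_const (a := 0) (b := 1) (C := 3 * n / k)
    (f := fun t : ℝ => ((1 + t / k) ^ ((n : ℝ) - 3 / 2) - 1) * (t - 1 / 2)) ?_
  · simpa using this
  intro t ht
  rw [Set.uIoc_of_le zero_le_one] at ht
  have h1 := aux_le_exp n k hn hk1 t ht.1.le ht.2
  have h2 : 1 ≤ (1 + t / k) ^ ((n : ℝ) - 3 / 2) := by
    apply one_le_rpow _ (by linarith)
    have : 0 ≤ t / k := div_nonneg ht.1.le hk'.le
    linarith
  have h3 : exp ((n : ℝ) / k) - 1 ≤ 3 * (n / k) := by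
    set a := (n : ℝ) / k with ha
    have ha0 : 0 ≤ a := by positivity
    have ha1 : a ≤ 1 := by
      rw [ha, div_le_one hk']; exact_mod_cast hk
    have h4 := Real.add_one_le_exp (-a)
    have h5 : exp a * exp (-a) = 1 := by rw [← Real.exp_add]; simp
    have h6 : exp a ≤ 3 := (Real.exp_le_exp.mpr ha1).trans (by linarith [Real.exp_one_lt_d9])
    nlinarith [Real.exp_pos a]
  rw [norm_mul, Real.norm_eq_abs, Real.norm_eq_abs, abs_of_nonneg (by linarith)]
  have h7 : |t - 1 / 2| ≤ 1 := abs_le.mpr ⟨by linarith [ht.1], by linarith [ht.2]⟩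
  calc _ ≤ (3 * (n / k : ℝ)) * 1 := by gcongr; linarith
    _ = _ := by ring

theorem aux_BD (n k : ℕ) (hk : 1 ≤ k) :
    (∫ t in (0:ℝ)..1, ((k : ℝ) + t) ^ ((n : ℝ) - 3 / 2) * (t - 1 / 2)) *
      (∑' l : ℕ, ((k + 1 + l : ℕ) : ℝ) ^ (-(n : ℝ) - 1 / 2)) =
    ((∫ t in (0:ℝ)..1, (1 + t / k) ^ ((n : ℝ) - 3 / 2) * (t - 1 / 2)) *
      ∑' l : ℕ, (1 + ((l : ℝ) + 1) / k) ^ (-(n : ℝ) - 1 / 2)) / (k : ℝ) ^ 2 := by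
  have hk' : (0 : ℝ) < k := by exact_mod_cast hk
  have e1 : (∫ t in (0:ℝ)..1, ((k : ℝ) + t) ^ ((n : ℝ) - 3 / 2) * (t - 1 / 2)) =
      (k : ℝ) ^ ((n : ℝ) - 3 / 2) *
      ∫ t in (0:ℝ)..1, (1 + t / k) ^ ((n : ℝ) - 3 / 2) * (t - 1 / 2) := by
    rw [← intervalIntegral.integral_const_mul]
    apply intervalIntegral.integral_congr
    intro t ht
    rw [Set.uIcc_of_le zero_le_one] at ht
    have : 0 ≤ t / k := div_nonneg ht.1 hk'.le
    simp only
    rw [← mul_assoc, ← mul_rpow hk'.le (by positivity)]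
    congr 2
    field_simp
  have e2 : (∑' l : ℕ, ((k + 1 + l : ℕ) : ℝ) ^ (-(n : ℝ) - 1 / 2)) =
      (k : ℝ) ^ (-(n : ℝ) - 1 / 2) * ∑' l : ℕ, (1 + ((l : ℝ) + 1) / k) ^ (-(n : ℝ) - 1 / 2) := by
    rw [← tsum_mul_left]
    congr 1
    ext l
    rw [← mul_rpow hk'.le (by positivity)]
    congr 1
    push_cast
    field_simp
    ring
  rw [e1, e2]
  have e3 : (k : ℝ) ^ ((n : ℝ) - 3 / 2) * (k : ℝ) ^ (-(n : ℝ) - 1 / 2) = ((k : ℝ) ^ 2)⁻¹ := by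
    rw [← rpow_add hk', ← rpow_natCast, ← rpow_neg hk'.le]
    congr 1
    push_cast
    ring
  rw [div_eq_mul_inv _ ((k : ℝ) ^ 2), ← e3]
  ring

theorem aux_BD_bound (n k : ℕ) (hn : 2 ≤ n) (hk : n ≤ k) :
    |(∫ t in (0:ℝ)..1, (1 + t / k) ^ ((n : ℝ) - 3 / 2) * (t - 1 / 2)) *
      ∑' l : ℕ, (1 + ((l : ℝ) + 1) / k) ^ (-(n : ℝ) - 1 / 2)| ≤ 6 := by
  have hk1 : 1 ≤ k := by omega
  have hk' : (0 : ℝ) < k := by exact_mod_cast hk1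
  have hn' : (2 : ℝ) ≤ n := by exact_mod_cast hn
  rw [abs_mul]
  calc _ ≤ (3 * n / k : ℝ) * (2 * k / n) :=
        mul_le_mul (aux_b_bound n k hn hk) (aux_d_bound n k hn hk1) (abs_nonneg _) (by positivity)
    _ = 6 := by field_simp; norm_num

theorem aux_pt (κ : ℕ → ℕ) (α s r : ℝ) (hκ : Tendsto (fun n => (κ n : ℝ)) atTop atTop)
    (hα : Tendsto (fun n : ℕ => (n : ℝ) / κ n) atTop (𝓝 α)) (hs : 0 ≤ s) :
    Tendsto (fun n : ℕ => (1 + s / κ n) ^ ((n : ℝ) + r)) atTop (𝓝 (exp (α * s))) := by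
  have h1 : Tendsto (fun n : ℕ => (n : ℝ) * (s / κ n)) atTop (𝓝 (α * s)) := by
    refine (hα.mul_const s).congr fun n => by ring
  have h2 := Real.tendsto_one_add_pow_exp_of_tendsto h1
  have h3 : Tendsto (fun n : ℕ => (1 + s / κ n)) atTop (𝓝 1) := by
    simpa using (hκ.const_div_atTop s).const_add 1
  have h4 : Tendsto (fun n : ℕ => (1 + s / κ n) ^ r) atTop (𝓝 1) := by
    simpa using h3.rpow_const (p := r) (Or.inl one_ne_zero)
  have h5 := h2.mul h4
  rw [mul_one] at h5
  refine h5.congr fun n => ?_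
  have : 0 < 1 + s / κ n := by positivity
  rw [rpow_add this, rpow_natCast]

theorem aux_b_lim (κ : ℕ → ℕ) (α : ℝ) (hκ : Tendsto (fun n => (κ n : ℝ)) atTop atTop)
    (hκn : ∀ n, n ≤ κ n)
    (hα : Tendsto (fun n : ℕ => (n : ℝ) / κ n) atTop (𝓝 α)) :
    Tendsto (fun n : ℕ => ∫ t in (0:ℝ)..1, (1 + t / κ n) ^ ((n : ℝ) - 3 / 2) * (t - 1 / 2)) atTop
      (𝓝 (∫ t in (0:ℝ)..1, exp (α * t) * (t - 1 / 2))) := by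
  apply intervalIntegral.tendsto_integral_filter_of_dominated_convergence (fun _ => (3 : ℝ))
  · filter_upwards [eventually_ge_atTop 2] with n hn
    rw [Set.uIoc_of_le zero_le_one]
    exact ((aux_cont n (κ n) (by have := hκn n; omega)).mono
      Set.Ioc_subset_Icc_self).aestronglyMeasurable measurableSet_Ioc
  · filter_upwards [eventually_ge_atTop 2] with n hn
    refine Eventually.of_forall fun t ht => ?_
    rw [Set.uIoc_of_le zero_le_one] at ht
    have hk1 : 1 ≤ κ n := by have := hκn n; omega
    have hk' : (0 : ℝ) < κ n := by exact_mod_cast hk1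
    have h1 := aux_le_exp n (κ n) hn hk1 t ht.1.le ht.2
    have ha1 : (n : ℝ) / κ n ≤ 1 := by
      rw [div_le_one hk']; exact_mod_cast hκn n
    have h6 : exp ((n : ℝ) / κ n) ≤ 3 :=
      (Real.exp_le_exp.mpr ha1).trans (by linarith [Real.exp_one_lt_d9])
    have h7 : |t - 1 / 2| ≤ 1 := abs_le.mpr ⟨by linarith [ht.1], by linarith [ht.2]⟩
    have h8 : 0 ≤ (1 + t / κ n) ^ ((n : ℝ) - 3 / 2) := by
      have : 0 ≤ t / κ n := div_nonneg ht.1.le hk'.le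
      positivity
    rw [norm_mul, Real.norm_eq_abs, Real.norm_eq_abs, abs_of_nonneg h8]
    calc _ ≤ (3 : ℝ) * 1 := by gcongr; linarith
      _ = _ := by ring
  · simp
  · refine Eventually.of_forall fun t ht => ?_
    rw [Set.uIoc_of_le zero_le_one] at ht
    exact (aux_pt κ α t (-(3 / 2)) hκ hα ht.1.le).mul_const _

theorem aux_d_lim (κ : ℕ → ℕ) (α : ℝ) (h0 : 0 < α) (hκ : Tendsto (fun n => (κ n : ℝ)) atTop atTop)
    (hκn : ∀ n, n ≤ κ n)
    (hα : Tendsto (fun n : ℕ => (n : ℝ) / κ n) atTop (𝓝 α)) :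
    Tendsto (fun n : ℕ => ∑' l : ℕ, (1 + ((l : ℝ) + 1) / κ n) ^ (-(n : ℝ) - 1 / 2)) atTop
      (𝓝 (1 / (exp α - 1))) := by
  have e : 1 / (exp α - 1) = ∑' l : ℕ, exp (-(α * ((l : ℝ) + 1))) := by
    have : ∀ l : ℕ, exp (-(α * ((l : ℝ) + 1))) = exp (-α) * exp (-α) ^ l := by
      intro l
      rw [← Real.exp_nat_mul, ← Real.exp_add]
      congr 1
      ring
    simp_rw [this]
    have h1 : exp (-α) < 1 := by rw [Real.exp_lt_one_iff]; linarith
    rw [tsum_mul_left, tsum_geometric_of_lt_one (Real.exp_pos _).le h1]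
    have h2 : 1 < exp α := Real.one_lt_exp_iff.mpr h0
    rw [Real.exp_neg]
    have h3 : exp α - 1 ≠ 0 := by linarith
    field_simp
  rw [e]
  refine tendsto_tsum_of_dominated_convergence (aux_summable (α / 4) (by positivity)) ?_ ?_
  · intro l
    have := (aux_pt κ α ((l : ℝ) + 1) (1 / 2) hκ hα (by positivity)).inv₀ (Real.exp_pos _).ne'
    rw [← Real.exp_neg] at this
    refine this.congr fun n => ?_
    rw [← rpow_neg (by positivity)]
    congr 1
    ring
  · filter_upwards [eventually_ge_atTop 2, hα.eventually (lt_mem_nhds (half_lt_self h0))] with n hn hn2 l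
    have hk1 : 1 ≤ κ n := by have := hκn n; omega
    rw [Real.norm_eq_abs, abs_of_nonneg (by positivity)]
    refine (aux_term n (κ n) hn hk1 l).trans ?_
    apply one_div_le_one_div_of_le (by positivity)
    have : α / 4 ≤ (n : ℝ) / (2 * κ n) := by
      have : (n : ℝ) / (2 * κ n) = (n / κ n) / 2 := by field_simp
      rw [this]; linarith
    gcongr

theorem aux_phi_int (α : ℝ) (h0 : 0 < α) :
    ∫ t in (0:ℝ)..1, exp (α * t) * (t - 1 / 2) =
      (α * exp α - 2 * exp α + α + 2) / (2 * α ^ 2) := by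
  rw [intervalIntegral.integral_eq_sub_of_hasDerivAt
    (f := fun t => exp (α * t) * ((t - 1 / 2) / α - 1 / α ^ 2))]
  · simp
    field_simp
    ring
  · intro t _
    have h1 : HasDerivAt (fun t => exp (α * t)) (exp (α * t) * α) t := by
      simpa using ((hasDerivAt_id t).const_mul α).exp
    have h2 : HasDerivAt (fun t : ℝ => ((t - 1 / 2) / α - 1 / α ^ 2)) (1 / α) t := by
      exact (((hasDerivAt_id t).sub_const (1 / 2)).div_const α).sub_const (1 / α ^ 2)
    refine (h1.mul h2).congr_deriv ?_
    field_simp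
    ring
  · apply Continuous.intervalIntegrable
    fun_prop

theorem aux_cov (φ : ℝ → ℝ) :
    ∫ α in (0:ℝ)..1, φ α = ∫ x in Set.Ioi (0:ℝ), (1 / (1 + x) ^ 2) * φ (1 / (1 + x)) := by
  have him : (fun x : ℝ => 1 / (1 + x)) '' Set.Ioi 0 = Set.Ioo 0 1 := by
    ext y
    simp only [Set.mem_image, Set.mem_Ioi, Set.mem_Ioo]
    constructor
    · rintro ⟨x, hx, rfl⟩
      refine ⟨by positivity, ?_⟩
      rw [div_lt_one (by positivity)]
      linarith
    · rintro ⟨h1, h2⟩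
      refine ⟨1 / y - 1, ?_, ?_⟩
      · have := one_lt_one_div h1 h2
        linarith
      · simp
  rw [intervalIntegral.integral_of_le zero_le_one, MeasureTheory.integral_Ioc_eq_integral_Ioo, ← him,
    MeasureTheory.integral_image_eq_integral_abs_deriv_smul (f' := fun x => -1 / (1 + x) ^ 2) measurableSet_Ioi]
  · apply MeasureTheory.setIntegral_congr_fun measurableSet_Ioi
    intro x hx
    simp only [smul_eq_mul]
    congr 1
    rw [abs_div, abs_neg, abs_one, abs_of_nonneg (by positivity)]
  · intro x hx
    have hx' : (0 : ℝ) < x := hx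
    have h : HasDerivAt (fun x : ℝ => 1 + x) 1 x := by
      simpa using (hasDerivAt_id x).const_add 1
    have := h.inv (by positivity)
    simp only [one_div]
    exact this.hasDerivWithinAt
  · intro x hx y hy h
    have hx' : (0 : ℝ) < x := hx
    have hy' : (0 : ℝ) < y := hy
    simp only [one_div] at h
    have := inv_injective h
    linarith

theorem aux_inv_sq (y : ℝ) (hy : 0 ≤ y) : 1 / (1 + y) ^ 2 ≤ (1 + y ^ 2)⁻¹ := by
  rw [← one_div]
  apply one_div_le_one_div_of_le (by positivity)
  nlinarith

theorem aux_step (g : ℕ → ℝ) (C : ℝ) (hC : 0 ≤ C) (hg : ∀ j : ℕ, |g j| ≤ C / (2 + (j : ℝ)) ^ 2) :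
    ∑' j, g j = ∫ y in Set.Ioi (0:ℝ), g ⌊y⌋₊ := by
  have hU : (⋃ j : ℕ, Set.Ico (j : ℝ) (j + 1)) = Set.Ici 0 := by
    ext y
    simp only [Set.mem_iUnion, Set.mem_Ico, Set.mem_Ici]
    constructor
    · rintro ⟨j, h1, _⟩
      exact (Nat.cast_nonneg j).trans h1
    · intro h
      exact ⟨⌊y⌋₊, Nat.floor_le h, Nat.lt_floor_add_one y⟩
  have hint : MeasureTheory.IntegrableOn (fun y : ℝ => g ⌊y⌋₊) (Set.Ici 0) := by
    refine MeasureTheory.Integrable.mono' (g := fun y => C * (1 + y ^ 2)⁻¹)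
      ((integrable_inv_one_add_sq.const_mul C).integrableOn) ?_ ?_
    · exact ((measurable_from_nat (f := g)).comp Nat.measurable_floor).aestronglyMeasurable
    · refine (MeasureTheory.ae_restrict_iff' measurableSet_Ici).mpr (Eventually.of_forall fun y hy => ?_)
      have hy' : (0 : ℝ) ≤ y := hy
      refine (hg _).trans ?_
      rw [div_eq_mul_one_div]
      refine mul_le_mul_of_nonneg_left ((one_div_le_one_div_of_le (by positivity) ?_).trans
        (aux_inv_sq y hy')) hC
      apply pow_le_pow_left₀ (by positivity)
      linarith [Nat.lt_floor_add_one y]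
  rw [← hU] at hint
  have hd : Pairwise (Function.onFun Disjoint (fun j : ℕ => Set.Ico (j : ℝ) (j + 1))) := by
    intro i j hij
    rw [Function.onFun, Set.disjoint_left]
    rintro y ⟨h1, h2⟩ ⟨h3, h4⟩
    apply hij
    have h0 : (0 : ℝ) ≤ y := (Nat.cast_nonneg i).trans h1
    rw [← (Nat.floor_eq_iff h0).mpr ⟨h1, h2⟩, ← (Nat.floor_eq_iff h0).mpr ⟨h3, h4⟩]
  have hs := MeasureTheory.hasSum_integral_iUnion (fun j => measurableSet_Ico) hd hint
  rw [hU, MeasureTheory.integral_Ici_eq_integral_Ioi] at hs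
  rw [← hs.tsum_eq]
  congr 1
  ext j
  have : ∫ y in Set.Ico (j : ℝ) (j + 1), g ⌊y⌋₊ = ∫ y in Set.Ico (j : ℝ) (j + 1), g j := by
    apply MeasureTheory.setIntegral_congr_fun measurableSet_Ico
    intro y hy
    have h0 : (0 : ℝ) ≤ y := (Nat.cast_nonneg j).trans hy.1
    simp only
    rw [(Nat.floor_eq_iff h0).mpr hy]
  rw [this]
  simp

/-- `lim_{n→∞} (n−3/2) Σ_{k=n}^∞ B_k(n) D_k(n) = ∫₀¹ φ(α) dα`. -/
theorem stmt15
    (B : ℕ → ℕ → ℝ)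
    (hB : ∀ n k, B n k = ∫ t in (0:ℝ)..1, ((k : ℝ) + t) ^ ((n : ℝ) - 3 / 2) * (t - 1 / 2))
    (D : ℕ → ℕ → ℝ)
    (hD : ∀ n k, D n k = ∑' l : ℕ, ((k + 1 + l : ℕ) : ℝ) ^ (-(n : ℝ) - 1 / 2))
    (φ : ℝ → ℝ)
    (hφ : ∀ α, φ α = (α * exp α - 2 * exp α + α + 2) / (2 * α ^ 2 * (exp α - 1))) :
    Tendsto (fun n : ℕ => ((n : ℝ) - 3 / 2) * ∑' j : ℕ, B n (n + j) * D n (n + j))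
      atTop (𝓝 (∫ α in (0:ℝ)..1, φ α)) := by
  obtain ⟨H, hH⟩ : ∃ H : ℕ → ℕ → ℝ, ∀ n k, H n k =
    (∫ t in (0:ℝ)..1, (1 + t / k) ^ ((n : ℝ) - 3 / 2) * (t - 1 / 2)) *
      ∑' l : ℕ, (1 + ((l : ℝ) + 1) / k) ^ (-(n : ℝ) - 1 / 2) := ⟨fun n k => _, fun n k => rfl⟩
  have hBD : ∀ n k, 1 ≤ k → B n k * D n k = H n k / (k : ℝ) ^ 2 := by
    intro n k hk
    rw [hB, hD, hH, aux_BD n k hk]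
  have hHb : ∀ n k, 2 ≤ n → n ≤ k → |H n k| ≤ 6 := by
    intro n k hn hk
    rw [hH]
    exact aux_BD_bound n k hn hk
  rw [aux_cov φ]
  have key : ∀ n : ℕ, 2 ≤ n → ((n : ℝ) - 3 / 2) * ∑' j : ℕ, B n (n + j) * D n (n + j) =
      ∫ x in Set.Ioi (0:ℝ), ((n : ℝ) - 3 / 2) * n *
        (H n (n + ⌊(n : ℝ) * x⌋₊) / ((n + ⌊(n : ℝ) * x⌋₊ : ℕ) : ℝ) ^ 2) := by
    intro n hn
    have hn' : (2 : ℝ) ≤ n := by exact_mod_cast hn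
    have h1 : ∀ j, B n (n + j) * D n (n + j) = H n (n + j) / ((n + j : ℕ) : ℝ) ^ 2 :=
      fun j => hBD n _ (by omega)
    simp_rw [h1]
    rw [aux_step (fun j => H n (n + j) / ((n + j : ℕ) : ℝ) ^ 2) 6 (by norm_num),
      MeasureTheory.integral_const_mul,
      MeasureTheory.integral_comp_mul_left_Ioi (fun y => H n (n + ⌊y⌋₊) / ((n + ⌊y⌋₊ : ℕ) : ℝ) ^ 2) 0
        (show (0 : ℝ) < n by linarith)]
    · rw [mul_zero, smul_eq_mul]
      field_simp
    · intro j
      rw [abs_div, abs_of_nonneg (by positivity : (0 : ℝ) ≤ ((n + j : ℕ) : ℝ) ^ 2)]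
      have := hHb n (n + j) hn (by omega)
      push_cast
      gcongr
  have hcg : (fun n : ℕ => ∫ x in Set.Ioi (0:ℝ), ((n : ℝ) - 3 / 2) * n *
        (H n (n + ⌊(n : ℝ) * x⌋₊) / ((n + ⌊(n : ℝ) * x⌋₊ : ℕ) : ℝ) ^ 2)) =ᶠ[atTop]
      (fun n : ℕ => ((n : ℝ) - 3 / 2) * ∑' j : ℕ, B n (n + j) * D n (n + j)) := by
    filter_upwards [eventually_ge_atTop 2] with n hn
    exact (key n hn).symm
  refine Tendsto.congr' hcg ?_
  apply MeasureTheory.tendsto_integral_filter_of_dominated_convergence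
    (fun x => 24 * (1 + x ^ 2)⁻¹)
  · refine Eventually.of_forall fun n => ?_
    refine Measurable.aestronglyMeasurable ?_
    exact (measurable_from_nat (f := fun j => ((n : ℝ) - 3 / 2) * n *
        (H n (n + j) / ((n + j : ℕ) : ℝ) ^ 2))).comp
      (Nat.measurable_floor.comp (measurable_const_mul (n : ℝ)))
  · filter_upwards [eventually_ge_atTop 2] with n hn
    refine (MeasureTheory.ae_restrict_iff' measurableSet_Ioi).mpr (Eventually.of_forall fun x hx => ?_)
    have hx' : (0 : ℝ) < x := hx
    have hn' : (2 : ℝ) ≤ n := by exact_mod_cast hn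
    have h1 := hHb n (n + ⌊(n : ℝ) * x⌋₊) hn (by omega)
    have hfl := Nat.lt_floor_add_one ((n : ℝ) * x)
    have hK : (n : ℝ) * (1 + x) / 2 ≤ ((n + ⌊(n : ℝ) * x⌋₊ : ℕ) : ℝ) := by
      push_cast
      have h0 : (0 : ℝ) ≤ (n : ℝ) * x := by positivity
      nlinarith
    have hKpos : (0 : ℝ) < (n : ℝ) * (1 + x) / 2 := by positivity
    rw [Real.norm_eq_abs, abs_mul, abs_div, abs_of_nonneg (by positivity : (0 : ℝ) ≤ ((n + ⌊(n : ℝ) * x⌋₊ : ℕ) : ℝ) ^ 2),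
      abs_of_nonneg (mul_nonneg (by linarith) (by linarith) : (0 : ℝ) ≤ ((n : ℝ) - 3 / 2) * n)]
    calc _ ≤ ((n : ℝ) * n) * (6 / ((n : ℝ) * (1 + x) / 2) ^ 2) := by
          gcongr
          linarith
      _ = 24 * (1 / (1 + x) ^ 2) := by field_simp; norm_num
      _ ≤ _ := by linarith [aux_inv_sq x hx'.le]
  · exact (integrable_inv_one_add_sq.const_mul 24).integrableOn
  · refine (MeasureTheory.ae_restrict_iff' measurableSet_Ioi).mpr (Eventually.of_forall fun x hx => ?_)
    have hx' : (0 : ℝ) < x := hx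
    set κ : ℕ → ℕ := fun n => n + ⌊(n : ℝ) * x⌋₊ with hκd
    have hκn : ∀ n, n ≤ κ n := fun n => by simp [hκd]
    have hκ : Tendsto (fun n => (κ n : ℝ)) atTop atTop :=
      tendsto_atTop_mono (fun n => Nat.cast_le.mpr (hκn n)) tendsto_natCast_atTop_atTop
    have hr : Tendsto (fun n : ℕ => (κ n : ℝ) / n) atTop (𝓝 (1 + x)) := by
      have h := ((tendsto_nat_floor_mul_div_atTop hx'.le).comp
        (tendsto_natCast_atTop_atTop (R := ℝ))).const_add 1
      refine h.congr' ?_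
      filter_upwards [eventually_ge_atTop 1] with n hn
      have hn' : (1 : ℝ) ≤ n := by exact_mod_cast hn
      simp only [hκd, Function.comp]
      push_cast
      rw [mul_comm x]
      field_simp
    have hα : Tendsto (fun n : ℕ => (n : ℝ) / κ n) atTop (𝓝 (1 / (1 + x))) := by
      have := hr.inv₀ (by positivity)
      simpa using this
    have hα0 : 0 < 1 / (1 + x) := by positivity
    have hHl := (aux_b_lim κ _ hκ hκn hα).mul (aux_d_lim κ _ hα0 hκ hκn hα)
    have hφe : φ (1 / (1 + x)) = (∫ t in (0:ℝ)..1, exp (1 / (1 + x) * t) * (t - 1 / 2)) *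
        (1 / (exp (1 / (1 + x)) - 1)) := by
      rw [hφ, aux_phi_int _ hα0, div_mul_div_comm, mul_one]
    rw [← hφe] at hHl
    have hpre : Tendsto (fun n : ℕ => ((n : ℝ) / κ n - 3 / 2 / κ n) * (n / κ n)) atTop
        (𝓝 ((1 / (1 + x) - 0) * (1 / (1 + x)))) :=
      (hα.sub (hκ.const_div_atTop _)).mul hα
    have := hpre.mul hHl
    have e : 1 / (1 + x) ^ 2 = (1 / (1 + x) - 0) * (1 / (1 + x)) := by
      rw [sub_zero, div_mul_div_comm, one_mul, sq]
    rw [e]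
    refine this.congr fun n => ?_
    rw [← hH]
    ring
end

section
/- For integers n ≥ 2 and k ≥ 1, let B_k(n) = ∫₀¹ (k+t)^{n−3/2} (t−1/2) dt and D'_k(n) = Σ_{l=k+2}^∞ l^{−n−1/2}. Then lim_{n→∞} (n − 3/2) Σ_{k=1}^{n−1} B_k(n) D'_k(n) = ∫₁^∞ φ₁(α) dα, where φ₁(α) = (α − 2 + α e^{−α} + 2 e^{−α})/(2α² (e^α − 1)). -/
open Filter Real Topology

lemma aux_B (n k : ℕ) (hn : 2 ≤ n) :
    |∫ t in (0:ℝ)..1, ((k : ℝ) + t) ^ ((n : ℝ) - 3 / 2) * (t - 1 / 2)|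
      ≤ ((k:ℝ)+1) ^ ((n:ℝ) - 1/2) / ((n:ℝ) - 1/2) := by
  have hn' : (2:ℝ) ≤ n := by exact_mod_cast hn
  have hk : (0:ℝ) ≤ k := Nat.cast_nonneg k
  have hcont : Continuous fun t : ℝ => ((k : ℝ) + t) ^ ((n : ℝ) - 3 / 2) :=
    (continuous_const.add continuous_id).rpow_const (fun x => Or.inr (by linarith))
  have h1 : ‖∫ t in (0:ℝ)..1, ((k : ℝ) + t) ^ ((n : ℝ) - 3 / 2) * (t - 1 / 2)‖ ≤
      ∫ t in (0:ℝ)..1, ((k : ℝ) + t) ^ ((n : ℝ) - 3 / 2) := by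
    apply intervalIntegral.norm_integral_le_of_norm_le zero_le_one
    · refine Filter.Eventually.of_forall fun t ht => ?_
      have h0 : 0 ≤ ((k : ℝ) + t) ^ ((n : ℝ) - 3 / 2) := rpow_nonneg (by linarith [ht.1]) _
      rw [norm_mul, Real.norm_of_nonneg h0, Real.norm_eq_abs]
      have : |t - 1/2| ≤ 1 := abs_le.2 ⟨by linarith [ht.1], by linarith [ht.2]⟩
      nlinarith
    · exact hcont.intervalIntegrable _ _
  rw [Real.norm_eq_abs] at h1
  refine h1.trans ?_
  rw [intervalIntegral.integral_comp_add_left (fun t : ℝ => t ^ ((n : ℝ) - 3 / 2)),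
    integral_rpow (Or.inl (by linarith))]
  have e : (n:ℝ) - 3/2 + 1 = n - 1/2 := by ring
  rw [e]
  apply div_le_div_of_nonneg_right _ (by linarith)
  have : 0 ≤ ((k:ℝ) + 0) ^ ((n:ℝ) - 1/2) := rpow_nonneg (by linarith) _
  linarith

lemma aux_D (n k : ℕ) (hn : 2 ≤ n) :
    (∑' l : ℕ, ((k + 2 + l : ℕ) : ℝ) ^ (-(n : ℝ) - 1 / 2))
      ≤ ((k:ℝ)+1) ^ (-((n:ℝ) - 1/2)) / ((n:ℝ) - 1/2) := by
  have hn' : (2:ℝ) ≤ n := by exact_mod_cast hn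
  have hk : (0:ℝ) ≤ k := Nat.cast_nonneg k
  apply Real.tsum_le_of_sum_range_le
  · intro l; positivity
  intro m
  have h := AntitoneOn.sum_le_integral (x₀ := (k:ℝ)+1) (a := m)
    (f := fun x : ℝ => x ^ (-(n : ℝ) - 1 / 2)) (by
      intro x hx y hy hxy
      exact Real.rpow_le_rpow_of_nonpos (by linarith [hx.1]) hxy (by linarith))
  have e : ∑ i ∈ Finset.range m, ((k + 2 + i : ℕ) : ℝ) ^ (-(n : ℝ) - 1 / 2) =
      ∑ i ∈ Finset.range m, ((k:ℝ) + 1 + ((i + 1 : ℕ):ℝ)) ^ (-(n : ℝ) - 1 / 2) := by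
    refine Finset.sum_congr rfl fun i _ => ?_
    congr 1; push_cast; ring
  rw [e]
  refine h.trans ?_
  have hm : (0:ℝ) ≤ m := Nat.cast_nonneg m
  rw [integral_rpow (Or.inr ⟨by linarith, by
    rw [Set.uIcc_of_le (by linarith)]; intro hx; linarith [hx.1]⟩)]
  have e : -(n:ℝ) - 1/2 + 1 = -(n - 1/2) := by ring
  rw [e, div_neg, ← neg_div]
  apply div_le_div_of_nonneg_right _ (by linarith)
  have : 0 ≤ ((k:ℝ) + 1 + m) ^ (-((n:ℝ) - 1/2)) := rpow_nonneg (by linarith) _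
  linarith

lemma aux_sum_s16 (n : ℕ) (hn : 0 < n) (f : ℕ → ℝ) :
    ∫ x in (0:ℝ)..1, f ⌊(n:ℝ) * x⌋₊ = (n:ℝ)⁻¹ * ∑ k ∈ Finset.range n, f k := by
  have hn' : (n:ℝ) ≠ 0 := by positivity
  rw [intervalIntegral.integral_comp_mul_left (fun y : ℝ => f ⌊y⌋₊) hn', smul_eq_mul, mul_zero,
    mul_one]
  congr 1
  have hae : ∀ k : ℕ, ∀ᵐ y : ℝ, y ∈ Set.uIoc (k:ℝ) ((k+1 : ℕ):ℝ) → f k = f ⌊y⌋₊ := by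
    intro k
    have : ∀ᵐ y : ℝ, y ≠ ((k+1:ℕ):ℝ) := by
      simp [MeasureTheory.ae_iff]
    filter_upwards [this] with y hy hm
    rw [Set.uIoc_of_le (by push_cast; linarith)] at hm
    have : ⌊y⌋₊ = k := by
      rw [Nat.floor_eq_iff (le_trans (Nat.cast_nonneg k) hm.1.le)]
      refine ⟨hm.1.le, ?_⟩
      have := lt_of_le_of_ne hm.2 hy
      push_cast at this; exact this
    rw [this]
  have hint : ∀ k : ℕ, IntervalIntegrable (fun y : ℝ => f ⌊y⌋₊) MeasureTheory.volume (k:ℝ) ((k+1:ℕ):ℝ) := by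
    intro k
    refine (intervalIntegrable_const (c := f k)).congr_ae ?_
    rw [Filter.EventuallyEq, MeasureTheory.ae_restrict_iff' measurableSet_uIoc]
    exact hae k
  have h := intervalIntegral.sum_integral_adjacent_intervals (a := fun k : ℕ => (k:ℝ)) (n := n)
    (f := fun y : ℝ => f ⌊y⌋₊) (μ := MeasureTheory.volume) (fun k _ => hint k)
  simp only [Nat.cast_zero] at h
  rw [← h]
  refine Finset.sum_congr rfl fun k _ => ?_
  rw [← intervalIntegral.integral_congr_ae (hae k)]
  simp

lemma aux_exp (u : ℕ → ℕ) (e : ℕ → ℝ) (α s : ℝ) (hu : Tendsto (fun n => (u n : ℝ)) atTop atTop)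
    (he : Tendsto (fun n => e n / u n) atTop (𝓝 α)) :
    Tendsto (fun n => (1 + s / (u n : ℝ)) ^ (e n)) atTop (𝓝 (exp (α * s))) := by
  have h1 := (Real.tendsto_mul_log_one_add_div_atTop s).comp hu
  have h2 := (Real.continuous_exp.tendsto _).comp (he.mul h1)
  refine h2.congr' ?_
  have h3 : Tendsto (fun n => 1 + s / (u n : ℝ)) atTop (𝓝 (1 + 0)) :=
    tendsto_const_nhds.add (hu.const_div_atTop s)
  filter_upwards [hu.eventually_gt_atTop 0, h3.eventually (lt_mem_nhds (by norm_num : (0:ℝ) < 1 + 0))] with n hn hp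
  simp only [Function.comp]
  rw [Real.rpow_def_of_pos hp]
  congr 1
  field_simp

lemma aux_I (α : ℝ) (hα : 0 < α) : ∫ t in (0:ℝ)..1, exp (α * t) * (t - 1/2) =
    ((α - 2) * exp α + α + 2) / (2 * α ^ 2) := by
  have : ∀ t ∈ Set.uIcc (0:ℝ) 1, HasDerivAt (fun t : ℝ => exp (α * t) * ((t - 1/2) / α - 1 / α ^ 2))
      (exp (α * t) * (t - 1/2)) t := by
    intro t _
    have h1 : HasDerivAt (fun t : ℝ => exp (α * t)) (exp (α * t) * (α * 1)) t :=
      ((hasDerivAt_id t).const_mul α).exp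
    have h2 : HasDerivAt (fun t : ℝ => (t - 1/2) / α - 1 / α ^ 2) (1 / α) t :=
      (((hasDerivAt_id t).sub_const _).div_const α).sub_const _
    refine (h1.mul h2).congr_deriv ?_
    field_simp
    ring
  rw [intervalIntegral.integral_eq_sub_of_hasDerivAt this
    ((by fun_prop : Continuous fun t : ℝ => exp (α * t) * (t - 1/2)).intervalIntegrable _ _)]
  simp only [mul_one, mul_zero, exp_zero]
  field_simp
  ring

lemma aux_S (α : ℝ) (hα : 0 < α) : ∑' l : ℕ, exp (-α * ((l:ℝ) + 2)) =
    exp (-α) / (exp α - 1) := by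
  have h : ∀ l : ℕ, exp (-α * ((l:ℝ) + 2)) = exp (-α) ^ 2 * exp (-α) ^ l := by
    intro l
    rw [← pow_add, ← Real.exp_nat_mul]; congr 1; push_cast; ring
  simp_rw [h]
  rw [tsum_mul_left, tsum_geometric_of_lt_one (exp_pos _).le (by simpa using hα)]
  have h1 : 1 < exp α := by simpa using hα
  have h2 : exp α ≠ 0 := (exp_pos _).ne'
  have h3 : exp α - 1 ≠ 0 := by linarith
  rw [Real.exp_neg]
  have h4 : 1 - (exp α)⁻¹ ≠ 0 := by
    have := inv_lt_one_of_one_lt₀ h1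
    linarith
  have h5 : 1 - (exp α)⁻¹ = (exp α - 1) / exp α := by field_simp
  rw [h5]
  field_simp

lemma aux_lim (α : ℝ) (hα : 1 < α) (u : ℕ → ℕ) (hu : Tendsto (fun n => (u n : ℝ)) atTop atTop)
    (he : Tendsto (fun n : ℕ => (n:ℝ) / u n) atTop (𝓝 α)) :
    Tendsto (fun n : ℕ => ((n:ℝ) - 3/2) * n *
      ((∫ t in (0:ℝ)..1, ((u n : ℝ) + t) ^ ((n : ℝ) - 3 / 2) * (t - 1 / 2)) *
      ∑' l : ℕ, ((u n + 2 + l : ℕ) : ℝ) ^ (-(n : ℝ) - 1 / 2))) atTop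
      (𝓝 (α ^ 2 * (((α - 2) * exp α + α + 2) / (2 * α ^ 2) * (exp (-α) / (exp α - 1))))) := by
  have hα0 : 0 < α := by linarith
  have he1 : Tendsto (fun n : ℕ => ((n:ℝ) - 3/2) / u n) atTop (𝓝 α) := by
    have := he.sub (hu.const_div_atTop (3/2))
    simpa [sub_div] using this
  have he2 : Tendsto (fun n : ℕ => (-(n:ℝ) - 1/2) / u n) atTop (𝓝 (-α)) := by
    have := he.neg.sub (hu.const_div_atTop (1/2))
    simpa [sub_div, neg_div] using this
  have hI : Tendsto (fun n : ℕ => ∫ t in (0:ℝ)..1, (1 + t / (u n : ℝ)) ^ ((n : ℝ) - 3 / 2) * (t - 1 / 2))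
      atTop (𝓝 (((α - 2) * exp α + α + 2) / (2 * α ^ 2))) := by
    rw [← aux_I α hα0]
    apply intervalIntegral.tendsto_integral_filter_of_dominated_convergence (fun _ => exp (α + 1))
    · filter_upwards [eventually_ge_atTop 2] with n hn
      have hn' : (2:ℝ) ≤ n := by exact_mod_cast hn
      apply Continuous.aestronglyMeasurable
      apply Continuous.mul _ (by fun_prop)
      exact (by fun_prop : Continuous fun t : ℝ => 1 + t / (u n : ℝ)).rpow_const
        (fun x => Or.inr (by linarith))
    · filter_upwards [eventually_ge_atTop 2, hu.eventually_gt_atTop 0,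
        he1.eventually (gt_mem_nhds (by linarith : α < α + 1))] with n hn hu0 hb
      have hn' : (2:ℝ) ≤ n := by exact_mod_cast hn
      refine Filter.Eventually.of_forall fun t ht => ?_
      rw [Set.uIoc_of_le zero_le_one] at ht
      have hd : 0 ≤ t / (u n : ℝ) := div_nonneg ht.1.le hu0.le
      have h0 : 0 ≤ (1 + t / (u n : ℝ)) ^ ((n : ℝ) - 3 / 2) := rpow_nonneg (by linarith) _
      rw [norm_mul, Real.norm_of_nonneg h0, Real.norm_eq_abs]
      have h1 : |t - 1/2| ≤ 1 := abs_le.2 ⟨by linarith [ht.1], by linarith [ht.2]⟩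
      have h2 : (1 + t / (u n : ℝ)) ^ ((n : ℝ) - 3 / 2) ≤ exp (α + 1) := by
        calc (1 + t / (u n : ℝ)) ^ ((n : ℝ) - 3 / 2) ≤ (exp (t / (u n : ℝ))) ^ ((n : ℝ) - 3 / 2) := by
              apply Real.rpow_le_rpow (by linarith) _ (by linarith)
              linarith [Real.add_one_le_exp (t / (u n : ℝ))]
          _ = exp (t * (((n:ℝ) - 3/2) / u n)) := by
              rw [← Real.exp_mul]; congr 1; ring
          _ ≤ exp (α + 1) := by
              apply Real.exp_le_exp.2
              have : 0 ≤ ((n:ℝ) - 3/2) / u n := div_nonneg (by linarith) hu0.le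
              nlinarith [ht.1, ht.2]
      nlinarith [abs_nonneg (t - 1/2)]
    · exact intervalIntegrable_const
    · refine Filter.Eventually.of_forall fun t ht => ?_
      exact (aux_exp u _ α t hu he1).mul_const _
  have hS : Tendsto (fun n : ℕ => ∑' l : ℕ, (1 + ((l:ℝ) + 2) / (u n : ℝ)) ^ (-(n : ℝ) - 1 / 2))
      atTop (𝓝 (exp (-α) / (exp α - 1))) := by
    rw [← aux_S α hα0]
    apply tendsto_tsum_of_dominated_convergence (bound := fun l : ℕ => 4 * (((l + 1 : ℕ) : ℝ) ^ 2)⁻¹)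
    · apply Summable.mul_left
      exact (summable_nat_add_iff (f := fun l : ℕ => ((l:ℝ) ^ 2)⁻¹) 1).2
        (Real.summable_nat_pow_inv.2 (by norm_num))
    · intro l
      exact aux_exp u _ (-α) _ hu he2
    · filter_upwards [hu.eventually_ge_atTop 2, he.eventually (lt_mem_nhds hα)] with n hu2 hb l
      have hun : (u n : ℝ) ≤ n := by
        rw [lt_div_iff₀ (by linarith)] at hb; linarith
      have hl : (0:ℝ) ≤ l := Nat.cast_nonneg l
      have hd : 0 ≤ ((l:ℝ) + 2) / (u n : ℝ) := div_nonneg (by linarith) (by linarith)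
      rw [Real.norm_of_nonneg (rpow_nonneg (by linarith) _)]
      have hb2 : 1 + ((l:ℝ) + 2) / 2 ≤ (1 + ((l:ℝ) + 2) / (u n : ℝ)) ^ ((u n : ℝ) / 2) := by
        have := one_add_mul_self_le_rpow_one_add (s := ((l:ℝ) + 2) / (u n : ℝ)) (by linarith)
          (p := (u n : ℝ) / 2) (by linarith)
        refine le_trans (le_of_eq ?_) this
        have : (u n : ℝ) ≠ 0 := by linarith
        field_simp
      calc (1 + ((l:ℝ) + 2) / (u n : ℝ)) ^ (-(n : ℝ) - 1 / 2)
          ≤ (1 + ((l:ℝ) + 2) / (u n : ℝ)) ^ (-(u n : ℝ)) :=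
            Real.rpow_le_rpow_of_exponent_le (by linarith) (by linarith)
        _ = (((1 + ((l:ℝ) + 2) / (u n : ℝ)) ^ ((u n : ℝ) / 2)) ^ 2)⁻¹ := by
            rw [Real.rpow_neg (by linarith), ← Real.rpow_natCast, ← Real.rpow_mul (by linarith)]
            congr 2; push_cast; ring
        _ ≤ ((((l + 1 : ℕ) : ℝ) / 2) ^ 2)⁻¹ := by
            apply inv_anti₀ (by positivity)
            apply pow_le_pow_left₀ (by positivity)
            push_cast
            linarith
        _ = 4 * (((l + 1 : ℕ) : ℝ) ^ 2)⁻¹ := by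
            rw [div_pow, inv_div]; norm_num; ring
  have hT := (he1.mul he).mul (hI.mul hS)
  rw [← pow_two] at hT
  refine hT.congr' ?_
  filter_upwards [hu.eventually_gt_atTop 0] with n hu0
  have hI' : (∫ t in (0:ℝ)..1, ((u n : ℝ) + t) ^ ((n : ℝ) - 3 / 2) * (t - 1 / 2)) =
      (u n : ℝ) ^ ((n : ℝ) - 3 / 2) *
      ∫ t in (0:ℝ)..1, (1 + t / (u n : ℝ)) ^ ((n : ℝ) - 3 / 2) * (t - 1 / 2) := by
    rw [← intervalIntegral.integral_const_mul]
    apply intervalIntegral.integral_congr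
    intro t ht
    rw [Set.uIcc_of_le zero_le_one] at ht
    have hd : 0 ≤ t / (u n : ℝ) := div_nonneg ht.1 hu0.le
    simp only
    rw [← mul_assoc, ← Real.mul_rpow hu0.le (by linarith)]
    congr 2
    field_simp
  have hS' : (∑' l : ℕ, ((u n + 2 + l : ℕ) : ℝ) ^ (-(n : ℝ) - 1 / 2)) =
      (u n : ℝ) ^ (-(n : ℝ) - 1 / 2) *
      ∑' l : ℕ, (1 + ((l:ℝ) + 2) / (u n : ℝ)) ^ (-(n : ℝ) - 1 / 2) := by
    rw [← tsum_mul_left]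
    refine tsum_congr fun l => ?_
    rw [← Real.mul_rpow hu0.le (by positivity)]
    congr 1
    push_cast
    field_simp
    ring
  rw [hI', hS']
  have hp : (u n : ℝ) ^ ((n : ℝ) - 3 / 2) * (u n : ℝ) ^ (-(n : ℝ) - 1 / 2) = ((u n : ℝ) ^ 2)⁻¹ := by
    rw [← Real.rpow_add hu0, ← Real.rpow_natCast, ← Real.rpow_neg hu0.le]
    congr 1; push_cast; ring
  generalize (∫ t in (0:ℝ)..1, (1 + t / (u n : ℝ)) ^ ((n : ℝ) - 3 / 2) * (t - 1 / 2)) = I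
  generalize (∑' l : ℕ, (1 + ((l:ℝ) + 2) / (u n : ℝ)) ^ (-(n : ℝ) - 1 / 2)) = S
  calc _ = ((n:ℝ) - 3/2) * n * (((u n : ℝ) ^ 2)⁻¹ * (I * S)) := by field_simp
    _ = _ := by rw [← hp]; ring

/-- `lim_{n→∞} (n−3/2) Σ_{k=1}^{n−1} B_k(n) D'_k(n) = ∫₁^∞ φ₁(α) dα`. -/
theorem stmt16
    (B : ℕ → ℕ → ℝ)
    (hB : ∀ n k, B n k = ∫ t in (0:ℝ)..1, ((k : ℝ) + t) ^ ((n : ℝ) - 3 / 2) * (t - 1 / 2))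
    (D' : ℕ → ℕ → ℝ)
    (hD' : ∀ n k, D' n k = ∑' l : ℕ, ((k + 2 + l : ℕ) : ℝ) ^ (-(n : ℝ) - 1 / 2))
    (φ₁ : ℝ → ℝ)
    (hφ₁ : ∀ α, φ₁ α = (α - 2 + α * exp (-α) + 2 * exp (-α)) / (2 * α ^ 2 * (exp α - 1))) :
    Tendsto (fun n : ℕ => ((n : ℝ) - 3 / 2) * ∑ k ∈ Finset.Icc 1 (n - 1), B n k * D' n k)
      atTop (𝓝 (∫ α in Set.Ioi (1:ℝ), φ₁ α)) := by
  -- change of variables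
  have hcv : ∫ α in Set.Ioi (1:ℝ), φ₁ α = ∫ x in (0:ℝ)..1, (x⁻¹) ^ 2 * φ₁ x⁻¹ := by
    have himg : (fun x : ℝ => x⁻¹) '' Set.Ioo 0 1 = Set.Ioi 1 := by
      ext y
      constructor
      · rintro ⟨x, hx, rfl⟩
        exact (one_lt_inv₀ hx.1).2 hx.2
      · intro hy
        have hy' : (1:ℝ) < y := hy
        exact ⟨y⁻¹, ⟨by positivity, inv_lt_one_of_one_lt₀ hy'⟩, inv_inv y⟩
    rw [← himg, MeasureTheory.integral_image_eq_integral_abs_deriv_smul measurableSet_Ioo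
      (f' := fun x => -(x ^ 2)⁻¹)
      (fun x hx => (hasDerivAt_inv hx.1.ne').hasDerivWithinAt) (inv_injective.injOn),
      intervalIntegral.integral_of_le zero_le_one, ← MeasureTheory.integral_Ioc_eq_integral_Ioo]
    refine MeasureTheory.setIntegral_congr_fun measurableSet_Ioc fun x hx => ?_
    simp
  rw [hcv]
  set G : ℕ → ℕ → ℝ := fun n k => if k = 0 then 0 else ((n:ℝ) - 3/2) * n * (B n k * D' n k) with hG
  have hbound : ∀ n k, 2 ≤ n → |G n k| ≤ 1 := by
    intro n k hn
    have hn' : (2:ℝ) ≤ n := by exact_mod_cast hn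
    simp only [hG]
    split_ifs with h
    · simp
    have h1 := aux_B n k hn
    have h2 := aux_D n k hn
    rw [← hB] at h1
    rw [← hD'] at h2
    have h0 : 0 ≤ D' n k := by rw [hD']; exact tsum_nonneg fun l => by positivity
    have hk : (0:ℝ) < (k:ℝ) + 1 := by positivity
    have hp : ((k:ℝ)+1) ^ ((n:ℝ) - 1/2) * ((k:ℝ)+1) ^ (-((n:ℝ) - 1/2)) = 1 := by
      rw [← Real.rpow_add hk]; simp
    have hx : 0 ≤ ((n:ℝ) - 3/2) * n := by nlinarith
    have hy : 0 < (n:ℝ) - 1/2 := by linarith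
    have h3 : |B n k * D' n k| ≤ 1 / ((n:ℝ) - 1/2) ^ 2 := by
      rw [abs_mul, abs_of_nonneg h0]
      calc _ ≤ (((k:ℝ)+1) ^ ((n:ℝ) - 1/2) / ((n:ℝ) - 1/2)) *
            (((k:ℝ)+1) ^ (-((n:ℝ) - 1/2)) / ((n:ℝ) - 1/2)) :=
            mul_le_mul h1 h2 h0 (by positivity)
        _ = _ := by rw [div_mul_div_comm, hp, pow_two]
    rw [abs_mul, abs_of_nonneg hx]
    calc _ ≤ ((n:ℝ) - 3/2) * n * (1 / ((n:ℝ) - 1/2) ^ 2) := mul_le_mul_of_nonneg_left h3 hx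
      _ ≤ 1 := by
        rw [mul_one_div, div_le_one (by positivity)]
        nlinarith
  have hmain : Tendsto (fun n : ℕ => ∫ x in (0:ℝ)..1, G n ⌊(n:ℝ) * x⌋₊) atTop
      (𝓝 (∫ x in (0:ℝ)..1, (x⁻¹) ^ 2 * φ₁ x⁻¹)) := by
    apply intervalIntegral.tendsto_integral_filter_of_dominated_convergence (fun _ => 1)
    · refine Filter.Eventually.of_forall fun n => Measurable.aestronglyMeasurable ?_
      exact (measurable_from_nat (f := G n)).comp (Nat.measurable_floor.comp (measurable_const_mul _))
    · filter_upwards [eventually_ge_atTop 2] with n hn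
      exact Filter.Eventually.of_forall fun x _ => hbound n _ hn
    · exact intervalIntegrable_const
    · have : ∀ᵐ y : ℝ, y ≠ 1 := by simp [MeasureTheory.ae_iff]
      filter_upwards [this] with x hx1 hx
      rw [Set.uIoc_of_le zero_le_one] at hx
      have hx0 := hx.1
      have hxl : x < 1 := lt_of_le_of_ne hx.2 hx1
      have hnx : Tendsto (fun n : ℕ => (n:ℝ) * x) atTop atTop :=
        tendsto_natCast_atTop_atTop.atTop_mul_const hx0
      have hu : Tendsto (fun n : ℕ => ((⌊(n:ℝ) * x⌋₊ : ℕ) : ℝ)) atTop atTop :=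
        tendsto_natCast_atTop_atTop.comp (tendsto_nat_floor_atTop.comp hnx)
      have he : Tendsto (fun n : ℕ => (n:ℝ) / ((⌊(n:ℝ) * x⌋₊ : ℕ) : ℝ)) atTop (𝓝 x⁻¹) := by
        have h1 := (tendsto_nat_floor_div_atTop (R := ℝ)).comp hnx
        have h2 := (h1.inv₀ one_ne_zero).mul_const x⁻¹
        rw [inv_one, one_mul] at h2
        refine h2.congr fun n => ?_
        simp only [Function.comp, inv_div]
        field_simp
      have hL := aux_lim x⁻¹ ((one_lt_inv₀ hx0).2 hxl) (fun n => ⌊(n:ℝ) * x⌋₊) hu he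
      have hval : (x⁻¹) ^ 2 * φ₁ x⁻¹ = x⁻¹ ^ 2 * (((x⁻¹ - 2) * exp x⁻¹ + x⁻¹ + 2) / (2 * x⁻¹ ^ 2) * (exp (-x⁻¹) / (exp x⁻¹ - 1))) := by
        rw [hφ₁, div_mul_div_comm]
        congr 2
        have : exp x⁻¹ * exp (-x⁻¹) = 1 := by rw [← Real.exp_add]; simp
        linear_combination (-(x⁻¹ - 2)) * this
      rw [hval]
      refine hL.congr' ?_
      filter_upwards [hu.eventually_gt_atTop 0] with n hn
      have hn0 : ⌊(n:ℝ) * x⌋₊ ≠ 0 := by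
        intro h; rw [h] at hn; simp at hn
      simp only [hG, if_neg hn0, hB, hD']
  refine hmain.congr' ?_
  filter_upwards [eventually_ge_atTop 2] with n hn
  have hn0 : (n:ℝ) ≠ 0 := by positivity
  rw [aux_sum_s16 n (by omega) (G n)]
  have hs : Finset.Icc 1 (n-1) = (Finset.range n).erase 0 := by
    ext k; simp; omega
  rw [hs, ← Finset.sum_erase (Finset.range n) (a := 0) (f := G n) (by simp [hG]),
    Finset.mul_sum, Finset.mul_sum]
  refine Finset.sum_congr rfl fun k hk => ?_
  simp only [hG, if_neg (Finset.ne_of_mem_erase hk)]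
  field_simp
end

section
/- For integers n ≥ 2 and k ≥ 1, let B_k(n) = ∫₀¹ (k+t)^{n−3/2} (t−1/2) dt. Then lim_{n→∞} [ (n − 3/2) Σ_{k=1}^{n−1} B_k(n) (k+1)^{−n−1/2} − Σ_{k=1}^{n−1} 1/(2(k+1)) ] = ∫₁^∞ φ₂(α) dα, where φ₂(α) = (2 e^{−α} + α e^{−α} − 2)/(2α²). -/
open Filter Real Topology

namespace S17

noncomputable def F (n m : ℕ) : ℝ :=
  (1 - 1 / (m:ℝ)) ^ ((n:ℝ) - 1/2) / (2 * m)
    - (1 - (1 - 1 / (m:ℝ)) ^ ((n:ℝ) + 1/2)) / ((n:ℝ) + 1/2)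

noncomputable def h (x : ℝ) : ℝ := exp (-x⁻¹) / (2 * x) - (1 - exp (-x⁻¹))

lemma ceil_piece (G : ℕ → ℝ) (i : ℕ) :
    Set.EqOn (fun _ : ℝ => G (i+1)) (fun x : ℝ => G ⌈x⌉₊) (Set.uIoc (i:ℝ) ((i+1 : ℕ):ℝ)) := by
  intro x hx
  rw [Set.uIoc_of_le (by push_cast; linarith)] at hx
  have : ⌈x⌉₊ = i + 1 := by
    rw [Nat.ceil_eq_iff (by omega)]
    simpa using hx
  simp [this]

lemma ceil_int (G : ℕ → ℝ) (i : ℕ) :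
    IntervalIntegrable (fun x : ℝ => G ⌈x⌉₊) MeasureTheory.volume (i:ℝ) ((i+1 : ℕ):ℝ) :=
  (intervalIntegrable_const (c := G (i+1))).congr (ceil_piece G i)

lemma ceil_integral (G : ℕ → ℝ) (n : ℕ) :
    ∫ x in (0:ℝ)..n, G ⌈x⌉₊ = ∑ i ∈ Finset.range n, G (i+1) := by
  have := intervalIntegral.sum_integral_adjacent_intervals (μ := MeasureTheory.volume)
    (f := fun x : ℝ => G ⌈x⌉₊) (a := fun i : ℕ => (i:ℝ)) (n := n) (fun i _ => ceil_int G i)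
  simp only [Nat.cast_zero] at this
  rw [← this]
  refine Finset.sum_congr rfl fun i _ => ?_
  rw [← intervalIntegral.integral_congr_ae (Eventually.of_forall (ceil_piece G i))]
  simp

lemma riemann (G : ℕ → ℝ) (n : ℕ) (hn : 1 ≤ n) :
    ∫ x in (0:ℝ)..1, n * G ⌈(n:ℝ) * x⌉₊ = ∑ i ∈ Finset.range n, G (i+1) := by
  have hn' : (n:ℝ) ≠ 0 := by positivity
  rw [intervalIntegral.integral_const_mul,
    intervalIntegral.integral_comp_mul_left (fun y => G ⌈y⌉₊) hn']
  simp only [mul_zero, mul_one, smul_eq_mul]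
  rw [ceil_integral]
  field_simp

lemma bound (n m : ℕ) (hn : 1 ≤ n) (hm : 1 ≤ m) : ‖(n:ℝ) * F n m‖ ≤ 2 := by
  have hn' : (1:ℝ) ≤ n := by exact_mod_cast hn
  have hm' : (1:ℝ) ≤ m := by exact_mod_cast hm
  have hm0 : (0:ℝ) < m := by linarith
  have hq0 : 0 ≤ 1 - 1 / (m:ℝ) := by
    rw [sub_nonneg, div_le_one hm0]; exact hm'
  have hq1 : 1 - 1 / (m:ℝ) ≤ 1 := by
    have : 0 < 1 / (m:ℝ) := by positivity
    linarith
  have hqe : 1 - 1 / (m:ℝ) ≤ exp (-(1/(m:ℝ))) := by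
    have := add_one_le_exp (-(1/(m:ℝ))); linarith
  have h1 : (1 - 1 / (m:ℝ)) ^ ((n:ℝ) - 1/2) ≤ exp (-(((n:ℝ) - 1/2) / m)) := by
    calc _ ≤ (exp (-(1/(m:ℝ)))) ^ ((n:ℝ) - 1/2) := rpow_le_rpow hq0 hqe (by linarith)
      _ = _ := by rw [← exp_mul]; congr 1; ring
  have h2 : (n:ℝ) / m ≤ exp (((n:ℝ) - 1/2) / m) := by
    refine le_trans ?_ (add_one_le_exp _)
    rw [← sub_nonneg]
    have : ((n:ℝ) - 1/2) / m + 1 - n / m = (m - 1/2) / m := by field_simp; ring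
    rw [this]
    apply div_nonneg <;> linarith
  have h0 : 0 ≤ (1 - 1 / (m:ℝ)) ^ ((n:ℝ) - 1/2) := rpow_nonneg hq0 _
  have h3 : (n:ℝ)/m * (1 - 1 / (m:ℝ)) ^ ((n:ℝ) - 1/2) ≤ 1 := by
    calc _ ≤ exp (((n:ℝ) - 1/2) / m) * exp (-(((n:ℝ) - 1/2) / m)) := by gcongr
      _ = 1 := by rw [← exp_add]; simp
  have h3' : 0 ≤ (n:ℝ)/m * (1 - 1 / (m:ℝ)) ^ ((n:ℝ) - 1/2) := by positivity
  have h4 : 0 ≤ (1 - 1 / (m:ℝ)) ^ ((n:ℝ) + 1/2) := rpow_nonneg hq0 _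
  have h5 : (1 - 1 / (m:ℝ)) ^ ((n:ℝ) + 1/2) ≤ 1 := rpow_le_one hq0 hq1 (by linarith)
  have h6 : (n:ℝ) / (n + 1/2) ≤ 1 := by rw [div_le_one (by linarith)]; linarith
  have h6' : 0 ≤ (n:ℝ) / (n + 1/2) := by positivity
  have e : (n:ℝ) * F n m = (n:ℝ)/m * (1 - 1 / (m:ℝ)) ^ ((n:ℝ) - 1/2) / 2
      - (n:ℝ) / (n + 1/2) * (1 - (1 - 1 / (m:ℝ)) ^ ((n:ℝ) + 1/2)) := by
    unfold F; field_simp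
  rw [e, Real.norm_eq_abs, abs_le]
  have h7 : (n:ℝ) / (n + 1/2) * (1 - (1 - 1 / (m:ℝ)) ^ ((n:ℝ) + 1/2)) ≤ 1 :=
    mul_le_one₀ h6 (by linarith) (by linarith)
  have h8 : 0 ≤ (n:ℝ) / (n + 1/2) * (1 - (1 - 1 / (m:ℝ)) ^ ((n:ℝ) + 1/2)) :=
    mul_nonneg h6' (by linarith)
  constructor <;> linarith

lemma pointwise (x : ℝ) (hx : 0 < x) :
    Tendsto (fun n : ℕ => (n:ℝ) * F n ⌈(n:ℝ) * x⌉₊) atTop (𝓝 (h x)) := by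
  set M : ℕ → ℕ := fun n => ⌈(n:ℝ) * x⌉₊ with hM
  have hMt : Tendsto M atTop atTop :=
    tendsto_nat_ceil_atTop.comp (tendsto_natCast_atTop_atTop.atTop_mul_const hx)
  have hr : Tendsto (fun n : ℕ => (M n : ℝ) / n) atTop (𝓝 x) := by
    have := (tendsto_nat_ceil_mul_div_atTop (R := ℝ) hx.le).comp tendsto_natCast_atTop_atTop
    refine this.congr fun n => ?_
    simp [hM, mul_comm]
  have hr' : Tendsto (fun n : ℕ => (n : ℝ) / M n) atTop (𝓝 x⁻¹) := by
    refine (hr.inv₀ hx.ne').congr fun n => ?_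
    rw [inv_div]
  have hMR : Tendsto (fun n => (M n : ℝ)) atTop atTop := tendsto_natCast_atTop_atTop.comp hMt
  have hinv : Tendsto (fun n => (M n : ℝ)⁻¹) atTop (𝓝 0) := tendsto_inv_atTop_zero.comp hMR
  have hE : Tendsto (fun n => (1 - 1 / (M n : ℝ)) ^ (M n : ℝ)) atTop (𝓝 (exp (-1))) := by
    have := (Real.tendsto_one_add_div_pow_exp (-1)).comp hMt
    refine this.congr fun n => ?_
    simp only [Function.comp, rpow_natCast]
    congr 1; ring
  have hq : ∀ c : ℝ, Tendsto (fun n : ℕ => (1 - 1 / (M n : ℝ)) ^ ((n:ℝ) + c)) atTop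
      (𝓝 (exp (-x⁻¹))) := by
    intro c
    have hp : Tendsto (fun n : ℕ => ((n:ℝ) + c) / M n) atTop (𝓝 x⁻¹) := by
      have := hr'.add (hinv.const_mul c)
      simp only [mul_zero, add_zero] at this
      refine this.congr fun n => ?_
      ring
    have := hE.rpow hp (Or.inl (exp_pos _).ne')
    rw [← exp_mul, neg_one_mul] at this
    refine this.congr' ?_
    filter_upwards [hMt.eventually_ge_atTop 1] with n hn
    have h1 : (1:ℝ) ≤ M n := by exact_mod_cast hn
    rw [← rpow_mul]
    · congr 1; field_simp
    · rw [sub_nonneg, div_le_one (by linarith)]; exact h1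
  have hn1 : Tendsto (fun n : ℕ => (n:ℝ) / (n + 1/2)) atTop (𝓝 1) :=
    tendsto_natCast_div_add_atTop (1/2 : ℝ)
  have := ((hr'.mul (hq (-(1/2)))).div_const 2).sub
    (hn1.mul ((hq (1/2)).const_sub 1))
  have e : h x = x⁻¹ * exp (-x⁻¹) / 2 - 1 * (1 - exp (-x⁻¹)) := by
    unfold h; field_simp
  rw [e]
  refine this.congr fun n => ?_
  unfold F
  rw [← sub_eq_add_neg]
  ring

lemma limF : Tendsto (fun n : ℕ => ∑ i ∈ Finset.range n, F n (i+1)) atTop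
    (𝓝 (∫ x in (0:ℝ)..1, h x)) := by
  have key : Tendsto (fun n : ℕ => ∫ x in (0:ℝ)..1, (n:ℝ) * F n ⌈(n:ℝ) * x⌉₊) atTop
      (𝓝 (∫ x in (0:ℝ)..1, h x)) := by
    refine intervalIntegral.tendsto_integral_filter_of_dominated_convergence (fun _ => 2) ?_ ?_ ?_ ?_
    · refine Eventually.of_forall fun n => Measurable.aestronglyMeasurable ?_
      have : Measurable (F n) := measurable_from_top
      exact (this.comp (Nat.measurable_ceil.comp (measurable_const_mul _))).const_mul _
    · filter_upwards [eventually_ge_atTop 1] with n hn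
      refine Eventually.of_forall fun x hx => ?_
      rw [Set.uIoc_of_le zero_le_one] at hx
      refine bound n _ hn ?_
      have : (0:ℝ) < n := by exact_mod_cast hn
      exact Nat.ceil_pos.mpr (mul_pos this hx.1)
    · exact intervalIntegrable_const
    · refine Eventually.of_forall fun x hx => ?_
      rw [Set.uIoc_of_le zero_le_one] at hx
      exact pointwise x hx.1
  refine key.congr' ?_
  filter_upwards [eventually_ge_atTop 1] with n hn
  exact riemann (F n) n hn

lemma cov (φ₂ : ℝ → ℝ)
    (hφ₂ : ∀ α, φ₂ α = (2 * exp (-α) + α * exp (-α) - 2) / (2 * α ^ 2)) :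
    ∫ x in (0:ℝ)..1, h x = ∫ α in Set.Ioi (1:ℝ), φ₂ α := by
  have him : (fun x : ℝ => x⁻¹) '' Set.Ioi 1 = Set.Ioo 0 1 := by
    ext y
    constructor
    · rintro ⟨x, hx, rfl⟩
      have hx' : (1:ℝ) < x := hx
      exact ⟨by positivity, inv_lt_one_of_one_lt₀ hx'⟩
    · rintro ⟨h0, h1⟩
      exact ⟨y⁻¹, (one_lt_inv₀ h0).mpr h1, inv_inv y⟩
  rw [intervalIntegral.integral_of_le zero_le_one, MeasureTheory.integral_Ioc_eq_integral_Ioo,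
    ← him, MeasureTheory.integral_image_eq_integral_abs_deriv_smul (f' := fun x => -(x^2)⁻¹)
      measurableSet_Ioi]
  · refine MeasureTheory.setIntegral_congr_fun measurableSet_Ioi fun x hx => ?_
    have hx' : (0:ℝ) < x := lt_trans one_pos hx
    simp only [hφ₂, h, inv_inv, abs_neg, smul_eq_mul]
    rw [abs_of_pos (by positivity)]
    field_simp
    ring
  · intro x hx
    have hx' : (0:ℝ) < x := lt_trans one_pos hx
    exact (hasDerivAt_inv hx'.ne').hasDerivWithinAt
  · exact inv_injective.injOn

lemma Bint (s : ℝ) (hs : 0 < s) (k : ℝ) (hk : 0 < k) :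
    ∫ t in (0:ℝ)..1, (k + t) ^ s * (t - 1 / 2)
      = ((k+1)^(s+1) + k^(s+1)) / (2*(s+1))
        - ((k+1)^(s+2) - k^(s+2)) / ((s+1)*(s+2)) := by
  have hd : ∀ t ∈ Set.uIcc (0:ℝ) 1, HasDerivAt
      (fun t : ℝ => (k+t)^(s+1) * (t-1/2) / (s+1) - (k+t)^(s+2) / ((s+1)*(s+2)))
      ((k + t) ^ s * (t - 1 / 2)) t := by
    intro t ht
    rw [Set.uIcc_of_le zero_le_one] at ht
    have hp : 0 < k + t := by linarith [ht.1]
    have h0 : HasDerivAt (fun t : ℝ => k + t) 1 t := (hasDerivAt_id t).const_add k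
    have h1 := h0.rpow_const (p := s+1) (Or.inl hp.ne')
    have h2 := h0.rpow_const (p := s+2) (Or.inl hp.ne')
    have h3 : HasDerivAt (fun t : ℝ => t - 1/2) 1 t := (hasDerivAt_id t).sub_const _
    refine (((h1.mul h3).div_const (s+1)).sub (h2.div_const ((s+1)*(s+2)))).congr_deriv ?_
    have e1 : s + 1 - 1 = s := by ring
    have e2 : s + 2 - 1 = s + 1 := by ring
    rw [e1, e2]
    field_simp
    ring
  rw [intervalIntegral.integral_eq_sub_of_hasDerivAt hd]
  · simp only [add_zero]
    field_simp
    ring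
  · apply ContinuousOn.intervalIntegrable
    refine ContinuousOn.mul (ContinuousOn.rpow_const (by fun_prop) ?_) (by fun_prop)
    intro t _
    exact Or.inr hs.le

lemma term (n k : ℕ) (hn : 2 ≤ n) (hk : 1 ≤ k) :
    ((n : ℝ) - 3 / 2) * ((∫ t in (0:ℝ)..1, ((k : ℝ) + t) ^ ((n : ℝ) - 3 / 2) * (t - 1 / 2))
      * ((k : ℝ) + 1) ^ (-(n : ℝ) - 1 / 2)) - 1 / (2 * ((k : ℝ) + 1))
    = ((n:ℝ) - 3/2) / (n - 1/2) * F n (k+1) - 1 / (2 * ((n:ℝ) - 1/2)) * (1 / ((k:ℝ)+1)) := by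
  have hn' : (2:ℝ) ≤ n := by exact_mod_cast hn
  have hk' : (1:ℝ) ≤ k := by exact_mod_cast hk
  rw [Bint _ (by linarith) _ (by linarith)]
  have e1 : (n:ℝ) - 3/2 + 1 = n - 1/2 := by ring
  have e2 : (n:ℝ) - 3/2 + 2 = n + 1/2 := by ring
  rw [e1, e2]
  set p : ℝ := (n:ℝ) - 1/2 with hp
  have e3 : (n:ℝ) + 1/2 = p + 1 := by rw [hp]; ring
  have e4 : -(n:ℝ) - 1/2 = -(p + 1) := by rw [hp]; ring
  have e5 : (n:ℝ) - 3/2 = p - 1 := by rw [hp]; ring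
  have hp1 : 3/2 ≤ p := by rw [hp]; linarith
  have hkk : (0:ℝ) < k + 1 := by linarith
  have hq : 1 - 1 / ((k+1 : ℕ):ℝ) = k / (k+1) := by push_cast; field_simp; ring
  unfold F
  rw [← hp, e3, e4, e5, hq, div_rpow (by linarith) hkk.le, div_rpow (by linarith) hkk.le,
    rpow_neg hkk.le, rpow_add_one hkk.ne', rpow_add_one (by linarith : (k:ℝ) ≠ 0)]
  have hP : 0 < ((k:ℝ)+1)^p := rpow_pos_of_pos hkk _
  have hQ : 0 < (k:ℝ)^p := rpow_pos_of_pos (by linarith) _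
  push_cast
  generalize ((k:ℝ)+1)^p = P at *
  generalize (k:ℝ)^p = Q at *
  have : p ≠ 0 := by linarith
  have : p + 1 ≠ 0 := by linarith
  field_simp
  ring

lemma harm : Tendsto (fun n : ℕ => (n:ℝ)⁻¹ * ∑ i ∈ Finset.range n, 1 / ((i:ℝ)+1)) atTop (𝓝 0) :=
  (tendsto_one_div_add_atTop_nhds_zero_nat (𝕜 := ℝ)).cesaro

lemma sumIcc (f : ℕ → ℝ) (n : ℕ) (hn : 1 ≤ n) :
    ∑ k ∈ Finset.Icc 1 (n-1), f k = ∑ i ∈ Finset.range n, f i - f 0 := by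
  obtain ⟨m, rfl⟩ : ∃ m, n = m + 1 := ⟨n - 1, by omega⟩
  rw [Finset.sum_range_succ', Nat.add_sub_cancel, add_sub_cancel_right, Finset.range_eq_Ico,
    Finset.sum_Ico_add' f 0 m 1, zero_add]
  rfl

end S17

/-- Asymptotics of `(n−3/2) Σ_{k=1}^{n−1} B_k(n) (k+1)^{−n−1/2}`. -/
theorem stmt17
    (B : ℕ → ℕ → ℝ)
    (hB : ∀ n k, B n k = ∫ t in (0:ℝ)..1, ((k : ℝ) + t) ^ ((n : ℝ) - 3 / 2) * (t - 1 / 2))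
    (φ₂ : ℝ → ℝ)
    (hφ₂ : ∀ α, φ₂ α = (2 * exp (-α) + α * exp (-α) - 2) / (2 * α ^ 2)) :
    Tendsto (fun n : ℕ =>
        ((n : ℝ) - 3 / 2)
            * ∑ k ∈ Finset.Icc 1 (n - 1), B n k * ((k : ℝ) + 1) ^ (-(n : ℝ) - 1 / 2)
          - ∑ k ∈ Finset.Icc 1 (n - 1), 1 / (2 * ((k : ℝ) + 1)))
      atTop (𝓝 (∫ α in Set.Ioi (1:ℝ), φ₂ α)) := by
  rw [← S17.cov φ₂ hφ₂]
  have hc : ∀ c : ℝ, Tendsto (fun n : ℕ => ((n:ℝ) + c)⁻¹) atTop (𝓝 0) := fun c =>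
    tendsto_inv_atTop_zero.comp (tendsto_atTop_add_const_right _ c tendsto_natCast_atTop_atTop)
  have h1 : Tendsto (fun n : ℕ => 1 - ((n:ℝ) + (-(1/2)))⁻¹) atTop (𝓝 1) := by
    simpa using (hc (-(1/2))).const_sub 1
  have h2 : Tendsto (fun n : ℕ => (n:ℝ) / (n + (-(1/2)))) atTop (𝓝 1) :=
    tendsto_natCast_div_add_atTop (-(1/2) : ℝ)
  have h3 := (h1.mul (S17.limF.add (hc (1/2)))).sub
    (((h2.mul S17.harm).sub (hc (-(1/2)))).div_const 2)
  have e : (1:ℝ) * ((∫ x in (0:ℝ)..1, S17.h x) + 0) - (1 * 0 - 0) / 2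
    = ∫ x in (0:ℝ)..1, S17.h x := by ring
  rw [e] at h3
  refine h3.congr' ?_
  filter_upwards [eventually_ge_atTop 2] with n hn
  have hn' : (2:ℝ) ≤ n := by exact_mod_cast hn
  have hterm : ∀ k ∈ Finset.Icc 1 (n-1),
      ((n : ℝ) - 3 / 2) * (B n k * ((k : ℝ) + 1) ^ (-(n : ℝ) - 1 / 2)) - 1 / (2 * ((k : ℝ) + 1))
      = ((n:ℝ) - 3/2) / (n - 1/2) * S17.F n (k+1)
        - 1 / (2 * ((n:ℝ) - 1/2)) * (1 / ((k:ℝ)+1)) := by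
    intro k hk
    rw [hB]
    exact S17.term n k hn (Finset.mem_Icc.mp hk).1
  rw [Finset.mul_sum (Finset.Icc 1 (n-1)), ← Finset.sum_sub_distrib, Finset.sum_congr rfl hterm,
    Finset.sum_sub_distrib, ← Finset.mul_sum, ← Finset.mul_sum,
    S17.sumIcc (fun k => S17.F n (k+1)) n (by omega),
    S17.sumIcc (fun k => 1 / ((k:ℝ)+1)) n (by omega)]
  have hF0 : S17.F n (0+1) = -((n:ℝ) + 1/2)⁻¹ := by
    unfold S17.F
    simp only [zero_add, Nat.cast_one, div_one, sub_self]
    rw [zero_rpow (by linarith), zero_rpow (by linarith)]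
    ring
  simp only [hF0, Nat.cast_zero, zero_add]
  generalize ∑ i ∈ Finset.range n, S17.F n (i+1) = X
  generalize ∑ i ∈ Finset.range n, 1 / ((i:ℝ)+1) = Y
  have a1 : (n:ℝ) + -(1/2) ≠ 0 := by linarith
  have a2 : (n:ℝ) - 1/2 = n + -(1/2) := by ring
  have a3 : (n:ℝ) - 3/2 = (n + -(1/2)) - 1 := by ring
  have a4 : (n:ℝ) ≠ 0 := by linarith
  have a5 : (n:ℝ) / (n + -(1/2)) * ((n:ℝ)⁻¹ * Y) = (n + -(1/2) : ℝ)⁻¹ * Y := by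
    field_simp
  rw [a2, a3, a5, sub_div ((n:ℝ) + -(1/2)) 1, div_self a1]
  generalize (n:ℝ) + -(1/2) = p at *
  rw [one_div (2 * p), mul_inv]
  ring
end
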